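/- arXiv:1907.08762 — 2 statements merged into one kernel-verified Lean document; each statement's English description precedes it below -/
import Mathlib

section
/- Let X be a Fréchet topological space, let Y be a Tychonoff (T3.5) topological space, and let f : X → Y be a bijection such that for every pseudocompact subset K of X the restriction f|_K : K → f(K) is a homeomorphism (i.e., f is a witness of Ps-Tychonoffness of X). Then f is continuous. -/
open Set Topology Filter

universe u v

/-- A subset `K` of a topological space is pseudocompact if every continuous
real-valued function on `K` (with the subspace topology) is bounded. -/
def IsPseudocompactSet {X : Type u} [TopologicalSpace X] (K : Set X) : Prop :=
  ∀ f : K → ℝ, Continuous f → ∃ M : ℝ, ∀ x : K, |f x| ≤ M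

/-- A subset `K` is countably compact if every countable open cover of `K`
has a finite subcover. -/
def IsCountablyCompactSet {X : Type u} [TopologicalSpace X] (K : Set X) : Prop :=
  ∀ U : ℕ → Set X, (∀ n, IsOpen (U n)) → K ⊆ ⋃ n, U n →
    ∃ t : Finset ℕ, K ⊆ ⋃ n ∈ t, U n

/-- `f` restricts to a homeomorphism of `K` onto `f '' K`
(both with their subspace topologies). -/
def RestrictsToHomeo {X : Type u} {Y : Type v} [TopologicalSpace X] [TopologicalSpace Y]
    (f : X → Y) (K : Set X) : Prop :=
  ∃ e : K ≃ₜ (f '' K), ∀ x : K, (e x : Y) = f x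

/-- `X` is Ps-normal. -/
def PsNormal (X : Type u) [TopologicalSpace X] : Prop :=
  ∃ (Y : Type u) (_ : TopologicalSpace Y) (f : X → Y), NormalSpace Y ∧
    Function.Bijective f ∧ ∀ K : Set X, IsPseudocompactSet K → RestrictsToHomeo f K

/-- `X` is CC-normal. -/
def CCNormal (X : Type u) [TopologicalSpace X] : Prop :=
  ∃ (Y : Type u) (_ : TopologicalSpace Y) (f : X → Y), NormalSpace Y ∧
    Function.Bijective f ∧ ∀ K : Set X, IsCountablyCompactSet K → RestrictsToHomeo f K

/-- `X` is C-normal. -/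
def CNormal (X : Type u) [TopologicalSpace X] : Prop :=
  ∃ (Y : Type u) (_ : TopologicalSpace Y) (f : X → Y), NormalSpace Y ∧
    Function.Bijective f ∧ ∀ K : Set X, IsCompact K → RestrictsToHomeo f K

/-- `X` is Ps-Tychonoff. -/
def PsTychonoff (X : Type u) [TopologicalSpace X] : Prop :=
  ∃ (Y : Type u) (_ : TopologicalSpace Y) (f : X → Y), T35Space Y ∧
    Function.Bijective f ∧ ∀ K : Set X, IsPseudocompactSet K → RestrictsToHomeo f K

/-- `X` is C-Tychonoff. -/
def CTychonoff (X : Type u) [TopologicalSpace X] : Prop :=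
  ∃ (Y : Type u) (_ : TopologicalSpace Y) (f : X → Y), T35Space Y ∧
    Function.Bijective f ∧ ∀ K : Set X, IsCompact K → RestrictsToHomeo f K

/-- `X` is L-Tychonoff. -/
def LTychonoff (X : Type u) [TopologicalSpace X] : Prop :=
  ∃ (Y : Type u) (_ : TopologicalSpace Y) (f : X → Y), T35Space Y ∧
    Function.Bijective f ∧ ∀ K : Set X, IsLindelof K → RestrictsToHomeo f K

theorem IsCompact.isPseudocompactSet {X : Type u} [TopologicalSpace X] {K : Set X}
    (hK : IsCompact K) : IsPseudocompactSet K := by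
  intro g hg
  have : CompactSpace K := isCompact_iff_compactSpace.mp hK
  obtain ⟨M, hM⟩ := (isCompact_range hg.abs).bddAbove
  exact ⟨M, fun x => hM ⟨x, rfl⟩⟩

theorem RestrictsToHomeo.continuousOn {X : Type u} {Y : Type v} [TopologicalSpace X]
    [TopologicalSpace Y] {f : X → Y} {K : Set X} (h : RestrictsToHomeo f K) :
    ContinuousOn f K := by
  obtain ⟨e, he⟩ := h
  rw [continuousOn_iff_continuous_domRestrict]
  exact (continuous_subtype_val.comp e.continuous).congr he

/-- A witness of Ps-Tychonoffness of a Fréchet space is continuous. -/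
theorem continuous_of_psTychonoff_witness {X : Type u} {Y : Type v}
    [TopologicalSpace X] [TopologicalSpace Y] [FrechetUrysohnSpace X] [T35Space Y]
    (f : X → Y) (hf : Function.Bijective f)
    (hw : ∀ K : Set X, IsPseudocompactSet K → RestrictsToHomeo f K) :
    Continuous f := by
  refine SeqContinuous.continuous fun u x hu => ?_
  have hc := (hw _ hu.isCompact_insert_range.isPseudocompactSet).continuousOn
  exact (hc x (mem_insert _ _)).tendsto.comp <| tendsto_nhdsWithin_iff.mpr
    ⟨hu, Eventually.of_forall fun n => mem_insert_of_mem _ (mem_range_self n)⟩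
end

section
/- Ps-Tychonoffness is additive: if X_α is a Ps-Tychonoff topological space for every α ∈ Λ, then the topological sum ⊕_{α∈Λ} X_α is Ps-Tychonoff. -/
open Set Topology Filter

universe u v

/-- A continuous function on one summand extends to the topological sum, with a prescribed
constant value on all other summands. -/
theorem exists_continuous_sigma_extend {ι : Type*} {X : ι → Type*} {Z : Type*}
    [∀ i, TopologicalSpace (X i)] [TopologicalSpace Z] {i : ι} {f : X i → Z}
    (hf : Continuous f) (c : Z) :
    ∃ g : (Σ j, X j) → Z, Continuous g ∧ (∀ x, g ⟨i, x⟩ = f x) ∧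
      ∀ j, j ≠ i → ∀ x, g ⟨j, x⟩ = c := by
  classical
  refine ⟨fun p => if h : p.1 = i then f (h ▸ p.2) else c, ?_, ?_, ?_⟩
  · refine continuous_sigma fun j => ?_
    by_cases h : j = i
    · subst h
      simpa using hf
    · simpa [h] using continuous_const
  · intro x
    simp
  · intro j h x
    simp [h]

theorem completelyRegularSpace_sigma {ι : Type*} {X : ι → Type*}
    [∀ i, TopologicalSpace (X i)] [∀ i, CompletelyRegularSpace (X i)] :
    CompletelyRegularSpace (Σ i, X i) where
  completely_regular := by
    rintro ⟨i, x⟩ K hK hx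
    obtain ⟨f, hf, hfx, hfK⟩ := CompletelyRegularSpace.completely_regular x
      (Sigma.mk i ⁻¹' K) (isClosed_sigma_iff.1 hK i) hx
    obtain ⟨g, hg, hgi, hgc⟩ := exists_continuous_sigma_extend hf 1
    refine ⟨g, hg, (hgi x).trans hfx, ?_⟩
    rintro ⟨j, y⟩ hy
    by_cases h : j = i
    · subst h
      exact (hgi y).trans (hfK hy)
    · exact hgc j h y

theorem t35Space_sigma {ι : Type*} {X : ι → Type*}
    [∀ i, TopologicalSpace (X i)] [∀ i, T35Space (X i)] : T35Space (Σ i, X i) where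
  __ := (inferInstance : T0Space (Σ i, X i))
  __ := completelyRegularSpace_sigma

theorem restrictsToHomeo_iff_isEmbedding {X : Type u} {Y : Type v} [TopologicalSpace X]
    [TopologicalSpace Y] {f : X → Y} {K : Set X} :
    RestrictsToHomeo f K ↔ IsEmbedding (K.domRestrict f) := by
  constructor
  · rintro ⟨e, he⟩
    have h : K.domRestrict f = Subtype.val ∘ e := funext fun x => (he x).symm
    rw [h]
    exact IsEmbedding.subtypeVal.comp e.isEmbedding
  · intro h
    exact ⟨h.toHomeomorph.trans (Homeomorph.setCongr (range_domRestrict f K)), fun _ => rfl⟩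

/-- A subset of a topological sum is the topological sum of its traces on the summands. -/
theorem exists_homeomorph_sigma_preimage {ι : Type*} {X : ι → Type*}
    [∀ i, TopologicalSpace (X i)] (K : Set (Σ i, X i)) :
    ∃ e : (Σ i, (Sigma.mk i ⁻¹' K : Set (X i))) ≃ₜ K,
      ∀ i (x : (Sigma.mk i ⁻¹' K : Set (X i))), (e ⟨i, x⟩ : Σ i, X i) = ⟨i, x⟩ := by
  let g : (Σ i, (Sigma.mk i ⁻¹' K : Set (X i))) → K := fun p => ⟨⟨p.1, p.2⟩, p.2.2⟩
  have hval : IsEmbedding (Subtype.val ∘ g) :=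
    (isEmbedding_sigmaMap (f₁ := id)
      (f₂ := fun i => (Subtype.val : (Sigma.mk i ⁻¹' K : Set (X i)) → X i))
      Function.injective_id).2 fun _ => IsEmbedding.subtypeVal
  have hg : IsEmbedding g :=
    IsEmbedding.of_comp (hval.continuous.subtype_mk fun p => p.2.2) continuous_subtype_val hval
  have hsurj : Function.Surjective g := fun ⟨⟨i, x⟩, hx⟩ => ⟨⟨i, x, hx⟩, rfl⟩
  exact ⟨hg.toHomeomorphOfSurjective hsurj, fun _ _ => rfl⟩

theorem IsPseudocompactSet.preimage_sigmaMk {ι : Type u} {X : ι → Type u}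
    [∀ i, TopologicalSpace (X i)] {K : Set (Σ i, X i)} (hK : IsPseudocompactSet K) (i : ι) :
    IsPseudocompactSet (Sigma.mk i ⁻¹' K) := by
  intro f hf
  obtain ⟨e, -⟩ := exists_homeomorph_sigma_preimage K
  obtain ⟨g, hg, hgi, -⟩ := exists_continuous_sigma_extend
    (X := fun i => (Sigma.mk i ⁻¹' K : Set (X i))) hf 0
  obtain ⟨M, hM⟩ := hK (g ∘ e.symm) (hg.comp e.symm.continuous)
  refine ⟨M, fun x => ?_⟩
  simpa [hgi] using hM (e ⟨i, x⟩)

theorem RestrictsToHomeo.sigmaMap {ι : Type u} {X Y : ι → Type u}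
    [∀ i, TopologicalSpace (X i)] [∀ i, TopologicalSpace (Y i)] {f : ∀ i, X i → Y i}
    {K : Set (Σ i, X i)} (h : ∀ i, RestrictsToHomeo (f i) (Sigma.mk i ⁻¹' K)) :
    RestrictsToHomeo (Sigma.map id f : (Σ i, X i) → Σ i, Y i) K := by
  obtain ⟨e, he⟩ := exists_homeomorph_sigma_preimage K
  have hmap : IsEmbedding
      (Sigma.map id fun i => (Sigma.mk i ⁻¹' K).domRestrict (f i) :
        (Σ i, (Sigma.mk i ⁻¹' K : Set (X i))) → Σ i, Y i) :=
    (isEmbedding_sigmaMap Function.injective_id).2 fun i =>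
      restrictsToHomeo_iff_isEmbedding.1 (h i)
  rw [restrictsToHomeo_iff_isEmbedding]
  convert hmap.comp e.symm.isEmbedding using 1
  funext x
  obtain ⟨⟨i, y⟩, rfl⟩ := e.surjective x
  simp only [Function.comp_apply, e.symm_apply_apply, domRestrict_apply, he]
  rfl

/-- Ps-Tychonoffness is additive: a topological sum of Ps-Tychonoff spaces is
Ps-Tychonoff. -/
theorem psTychonoff_sigma {Λ : Type u} {Xa : Λ → Type u} [∀ α, TopologicalSpace (Xa α)]
    (h : ∀ α : Λ, PsTychonoff (Xa α)) : PsTychonoff (Σ α, Xa α) := by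
  choose Y tY f hY hf hK using h
  exact ⟨Σ α, Y α, inferInstance, Sigma.map id f, t35Space_sigma,
    ⟨Function.injective_id.sigma_map fun α => (hf α).1,
      Function.surjective_id.sigma_map fun α => (hf α).2⟩,
    fun K hpK => RestrictsToHomeo.sigmaMap fun α => hK α _ (hpK.preimage_sigmaMk α)⟩
end
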